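/- The number of OSASMs of order 2n+1 equals 2^{2n} times X^O_{2n+2}(1,-1), i.e., |OSASM(2n+1)| = 2^{2n} ∑_{A ∈ OSASM(2n+2)} (-1)^{T(A)}. -/

import Mathlib

open Finset

/-- An alternating sign matrix: entries in {-1,0,1}, all row/column prefix sums in {0,1}
(equivalent to the nonzero entries alternating in sign starting and ending with 1),
and all row and column sums equal to 1. -/
def IsASM {n : ℕ} (A : Matrix (Fin n) (Fin n) ℤ) : Prop :=
  (∀ i j, A i j = -1 ∨ A i j = 0 ∨ A i j = 1) ∧
  (∀ i k : Fin n, (∑ j ∈ Finset.univ.filter (fun j => j ≤ k), A i j) = 0 ∨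
                  (∑ j ∈ Finset.univ.filter (fun j => j ≤ k), A i j) = 1) ∧
  (∀ j k : Fin n, (∑ i ∈ Finset.univ.filter (fun i => i ≤ k), A i j) = 0 ∨
                  (∑ i ∈ Finset.univ.filter (fun i => i ≤ k), A i j) = 1) ∧
  (∀ i, ∑ j, A i j = 1) ∧
  (∀ j, ∑ i, A i j = 1)

/-- A diagonally symmetric ASM. -/
def IsDSASM {n : ℕ} (A : Matrix (Fin n) (Fin n) ℤ) : Prop :=
  IsASM A ∧ A.IsSymm

/-- An even-order off-diagonally symmetric ASM: a DSASM with all diagonal entries zero. -/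
def IsOSASMeven {n : ℕ} (A : Matrix (Fin n) (Fin n) ℤ) : Prop :=
  IsDSASM A ∧ ∀ i, A i i = 0

/-- An odd-order off-diagonally symmetric ASM: a DSASM with exactly one nonzero diagonal entry. -/
def IsOSASModd {n : ℕ} (A : Matrix (Fin n) (Fin n) ℤ) : Prop :=
  IsDSASM A ∧ (Finset.univ.filter (fun i => A i i ≠ 0)).card = 1

/-- R(A): the number of nonzero entries strictly above the diagonal. -/
def Rstat {n : ℕ} (A : Matrix (Fin n) (Fin n) ℤ) : ℕ :=
  ∑ p ∈ Finset.univ.filter (fun p : Fin n × Fin n => p.1 < p.2), (A p.1 p.2).natAbs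

/-- S(A): the number of nonzero diagonal entries. -/
def Sstat {n : ℕ} (A : Matrix (Fin n) (Fin n) ℤ) : ℕ :=
  ∑ i, (A i i).natAbs

/-- T(A): the (1-based) column index of the unique 1 in the first row
(for an ASM, the first row has a single nonzero entry, which equals 1). -/
def Tstat {n : ℕ} (A : Matrix (Fin n) (Fin n) ℤ) : ℕ :=
  ∑ p ∈ Finset.univ.filter (fun p : Fin n × Fin n => p.1.1 = 0),
    (p.2.1 + 1) * (A p.1 p.2).natAbs

section SixVertex

variable {R : Type*} [CommRing R]

/-- The row-to-row transfer operator of the six-vertex model with row parameter `z`, column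
parameters in the first list and `ω` a primitive cube root of unity. It acts on a function `f` of
the states of the vertical edges below the row, given the states `vs` of the vertical edges above
it and the state `h` of the horizontal edge at its left end; the right end carries `false`. -/
def rowOp (ω z : R) : List R → Bool → (List Bool → R) → List Bool → R
  | [], h, f, vs => bif h then 0 else f vs
  | _ :: _, _, _, [] => 0
  | y :: ys, false, f, false :: vs =>
      (ω * (z * y) - 1) * rowOp ω z ys false (fun l => f (false :: l)) vs
  | y :: ys, true, f, true :: vs =>
      (ω * (z * y) - 1) * rowOp ω z ys true (fun l => f (true :: l)) vs
  | y :: ys, true, f, false :: vs =>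
      (ω - z * y) * rowOp ω z ys true (fun l => f (false :: l)) vs +
        (ω - 1) * rowOp ω z ys false (fun l => f (true :: l)) vs
  | y :: ys, false, f, true :: vs =>
      (ω - z * y) * rowOp ω z ys false (fun l => f (true :: l)) vs +
        (ω - 1) * (z * y) * rowOp ω z ys true (fun l => f (false :: l)) vs

/-- The weight of a diagonal vertex with parameter `z`, as a function of the states of its vertical
and horizontal edges. -/
def kmat (β : R) (γ : R → R) (z : R) : Bool → Bool → R
  | false, false => β
  | true, true => β * z
  | _, _ => γ z

/-- The partition function of the six-vertex model on a triangle whose `i`th row and `i`th column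
both carry the `i`th parameter of the first list, with the boundary states at the top given by the
second list. -/
def part (ω β : R) (γ : R → R) : List R → List Bool → R
  | [], _ => 1
  | _ :: _, [] => 0
  | z :: zs, v :: vs =>
      kmat β γ z v false * rowOp ω z zs false (part ω β γ zs) vs +
        kmat β γ z v true * rowOp ω z zs true (part ω β γ zs) vs

/-- The operator on functions of vertical edge states attached to a vertex joining the first two
columns, whose parameters are `x` and `y`. -/
def swapTop (ω x y : R) (f : List Bool → R) : List Bool → R
  | false :: false :: l => (ω * y - x) * f (false :: false :: l)
  | true :: true :: l => (ω * y - x) * f (true :: true :: l)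
  | false :: true :: l =>
      (ω - 1) * x * f (false :: true :: l) + ω ^ 2 * (x - y) * f (true :: false :: l)
  | true :: false :: l =>
      (ω - 1) * y * f (true :: false :: l) + ω ^ 2 * (x - y) * f (false :: true :: l)
  | _ => 0

/-- The operator `swapTop` acting on the columns with indices `k` and `k + 1`. -/
def swapAt (ω x y : R) : ℕ → (List Bool → R) → List Bool → R
  | 0, f, l => swapTop ω x y f l
  | _ + 1, _, [] => 0
  | k + 1, f, v :: l => swapAt ω x y k (fun l' => f (v :: l')) l

theorem rowOp_add (ω z : R) (ys : List R) (h : Bool) (f g : List Bool → R) (vs : List Bool) :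
    rowOp ω z ys h (fun l => f l + g l) vs = rowOp ω z ys h f vs + rowOp ω z ys h g vs := by
  induction ys generalizing h f g vs with
  | nil => cases h <;> simp [rowOp]
  | cons y ys ih =>
    rcases vs with _ | ⟨v, vs⟩
    · simp [rowOp]
    · cases h <;> cases v <;> simp only [rowOp, ih] <;> ring

theorem rowOp_mul (ω z : R) (ys : List R) (h : Bool) (c : R) (f : List Bool → R)
    (vs : List Bool) :
    rowOp ω z ys h (fun l => c * f l) vs = c * rowOp ω z ys h f vs := by
  induction ys generalizing h f vs with
  | nil => cases h <;> simp [rowOp]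
  | cons y ys ih =>
    rcases vs with _ | ⟨v, vs⟩
    · simp [rowOp]
    · cases h <;> cases v <;> simp only [rowOp, ih] <;> ring

theorem swapAt_add (ω x y : R) (k : ℕ) (f g : List Bool → R) (l : List Bool) :
    swapAt ω x y k (fun l => f l + g l) l = swapAt ω x y k f l + swapAt ω x y k g l := by
  induction k generalizing f g l with
  | zero => rcases l with _ | ⟨_ | _, _ | ⟨_ | _, l⟩⟩ <;> simp only [swapAt, swapTop] <;> ring
  | succ k ih => cases l <;> simp [swapAt, ih]

theorem swapAt_mul (ω x y : R) (k : ℕ) (c : R) (f : List Bool → R) (l : List Bool) :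
    swapAt ω x y k (fun l => c * f l) l = c * swapAt ω x y k f l := by
  induction k generalizing f l with
  | zero => rcases l with _ | ⟨_ | _, _ | ⟨_ | _, l⟩⟩ <;> simp only [swapAt, swapTop] <;> ring
  | succ k ih => cases l <;> simp [swapAt, ih]

theorem swapTop_rowOp {ω : R} (hω : ω ^ 2 + ω + 1 = 0) (x y z : R) (ys : List R) (h : Bool)
    (f : List Bool → R) (l : List Bool) :
    swapTop ω x y (rowOp ω z (x :: y :: ys) h f) l =
      rowOp ω z (y :: x :: ys) h (swapTop ω x y f) l := by
  have e : ω ^ 2 = -ω - 1 := by linear_combination hω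
  have e3 : ω ^ 3 = 1 := by linear_combination (ω - 1) * hω
  rcases l with _ | ⟨v, _ | ⟨w, l⟩⟩
  · cases h <;> simp [rowOp, swapTop]
  · cases h <;> cases v <;> simp [rowOp, swapTop]
  · cases h <;> cases v <;> cases w <;> simp only [rowOp, swapTop, rowOp_add, rowOp_mul] <;> grind

theorem rowOp_comm {ω : R} (hω : ω ^ 2 + ω + 1 = 0) (x y : R) (ys : List R)
    (f : List Bool → R) (l : List Bool) :
    (ω * y - x) * rowOp ω x ys false (rowOp ω y ys false f) l =
      (ω * y - x) * rowOp ω y ys false (rowOp ω x ys false f) l ∧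
    (ω * y - x) * rowOp ω x ys true (rowOp ω y ys true f) l =
      (ω * y - x) * rowOp ω y ys true (rowOp ω x ys true f) l ∧
    (ω - 1) * y * rowOp ω x ys false (rowOp ω y ys true f) l +
        ω ^ 2 * (x - y) * rowOp ω x ys true (rowOp ω y ys false f) l =
      (ω * y - x) * rowOp ω y ys false (rowOp ω x ys true f) l ∧
    (ω - 1) * x * rowOp ω x ys true (rowOp ω y ys false f) l +
        ω ^ 2 * (x - y) * rowOp ω x ys false (rowOp ω y ys true f) l =
      (ω * y - x) * rowOp ω y ys true (rowOp ω x ys false f) l := by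
  induction ys generalizing f l with
  | nil => simp [rowOp]
  | cons t ys ih =>
    rcases l with _ | ⟨v, l⟩
    · simp [rowOp]
    · obtain ⟨h1, h2, h3, h4⟩ := ih (fun l => f (false :: l)) l
      obtain ⟨k1, k2, k3, k4⟩ := ih (fun l => f (true :: l)) l
      clear ih
      cases v <;> simp only [rowOp, rowOp_add, rowOp_mul]
      · refine ⟨?_, ?_, ?_, ?_⟩
        · linear_combination (ω * (x * t) - 1) * (ω * (y * t) - 1) * h1
        · linear_combination (norm := skip) (ω - x * t) * (ω - y * t) * h2 +
            (ω - y * t) * (ω - 1) * k4 + (ω - 1) * (ω * (x * t) - 1) * k3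
          clear h1 h2 h3 h4 k1 k2 k3 k4
          grind
        · linear_combination (norm := skip) (ω * (y * t) - 1) * (ω - x * t) * h3 +
            (ω * (y * t) - 1) * (ω - 1) * k1
          clear h1 h2 h3 h4 k1 k2 k3 k4
          grind
        · linear_combination (norm := skip) (ω - y * t) * (ω * (x * t) - 1) * h4 +
            (ω - 1) * (ω - x * t) * k1 + (ω - 1) ^ 2 * (x * t) * h3
          clear h1 h2 h3 h4 k1 k2 k3 k4
          grind
      · refine ⟨?_, ?_, ?_, ?_⟩
        · linear_combination (norm := skip) (ω - y * t) * (ω - x * t) * k1 +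
            (ω - y * t) * (ω - 1) * (x * t) * h3 + (ω - 1) * (y * t) * (ω * (x * t) - 1) * h4
          clear h1 h2 h3 h4 k1 k2 k3 k4
          grind
        · linear_combination (ω * (x * t) - 1) * (ω * (y * t) - 1) * k2
        · linear_combination (norm := skip) (ω - y * t) * (ω * (x * t) - 1) * k3 +
            (ω - 1) * (y * t) * (ω - x * t) * h2 + (ω - 1) ^ 2 * (y * t) * k4
          clear h1 h2 h3 h4 k1 k2 k3 k4
          grind
        · linear_combination (norm := skip) (ω * (y * t) - 1) * (ω - x * t) * k4 +
            (ω * (y * t) - 1) * (ω - 1) * (x * t) * h2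
          clear h1 h2 h3 h4 k1 k2 k3 k4
          grind

theorem swapAt_rowOp {ω : R} (hω : ω ^ 2 + ω + 1 = 0) (x y z : R) (xs ys : List R) (h : Bool)
    (f : List Bool → R) (l : List Bool) :
    swapAt ω x y xs.length (rowOp ω z (xs ++ x :: y :: ys) h f) l =
      rowOp ω z (xs ++ y :: x :: ys) h (swapAt ω x y xs.length f) l := by
  induction xs generalizing h f l with
  | nil => exact swapTop_rowOp hω x y z ys h f l
  | cons t xs ih =>
    rcases l with _ | ⟨v, l⟩
    · simp [rowOp, swapAt]
    · cases h <;> cases v <;>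
        simp only [rowOp, swapAt, List.length_cons, List.cons_append, swapAt_add, swapAt_mul, ← ih]

theorem swapTop_part {ω : R} (hω : ω ^ 2 + ω + 1 = 0) {β : R} {γ : R → R}
    (hγ : ∀ x, β * γ x = β * (x + ω ^ 2)) (x y : R) (zs : List R) (l : List Bool) :
    swapTop ω x y (part ω β γ (x :: y :: zs)) l =
      (ω * y - x) * part ω β γ (y :: x :: zs) l := by
  have hx := hγ x
  have hy := hγ y
  rcases l with _ | ⟨v, _ | ⟨w, l⟩⟩
  · simp [swapTop, part]
  · cases v <;> simp [swapTop, part, rowOp]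
  · obtain ⟨h1, h2, h3, h4⟩ := rowOp_comm hω x y zs (part ω β γ zs) l
    cases v <;> cases w <;>
      simp only [rowOp, swapTop, part, kmat, rowOp_add, rowOp_mul]
    · linear_combination (norm := skip)
        (β * (ω * (y * x) - 1) * β + γ y * (ω - 1) * γ x) * h1 +
        (β * (ω * (y * x) - 1) * γ x + γ y * (ω - 1) * (β * x)) * h3 +
        γ y * (ω - y * x) * β * h4 + γ y * (ω - y * x) * γ x * h2
      clear h1 h2 h3 h4 hγ
      grind
    · linear_combination (norm := skip)
        (β * (ω - y * x) * γ x) * h1 +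
        (β * (ω - y * x) * (β * x)) * h3 +
        (β * ((ω - 1) * (y * x)) * β + γ y * (ω * (y * x) - 1) * γ x) * h4 +
        (β * ((ω - 1) * (y * x)) * γ x + γ y * (ω * (y * x) - 1) * (β * x)) * h2
      clear h1 h2 h3 h4 hγ
      grind
    · linear_combination (norm := skip)
        (γ y * (ω * (y * x) - 1) * β + β * y * (ω - 1) * γ x) * h1 +
        (γ y * (ω * (y * x) - 1) * γ x + β * y * (ω - 1) * (β * x)) * h3 +
        β * y * (ω - y * x) * β * h4 + β * y * (ω - y * x) * γ x * h2
      clear h1 h2 h3 h4 hγ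
      grind
    · linear_combination (norm := skip)
        (γ y * (ω - y * x) * γ x) * h1 +
        (γ y * (ω - y * x) * (β * x)) * h3 +
        (γ y * ((ω - 1) * (y * x)) * β + β * y * (ω * (y * x) - 1) * γ x) * h4 +
        (γ y * ((ω - 1) * (y * x)) * γ x + β * y * (ω * (y * x) - 1) * (β * x)) * h2
      clear h1 h2 h3 h4 hγ
      grind

theorem swapAt_part {ω : R} (hω : ω ^ 2 + ω + 1 = 0) {β : R} {γ : R → R}
    (hγ : ∀ x, β * γ x = β * (x + ω ^ 2)) (x y : R) (xs zs : List R) (l : List Bool) :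
    swapAt ω x y xs.length (part ω β γ (xs ++ x :: y :: zs)) l =
      (ω * y - x) * part ω β γ (xs ++ y :: x :: zs) l := by
  induction xs generalizing l with
  | nil => exact swapTop_part hω hγ x y zs l
  | cons t xs ih =>
    rcases l with _ | ⟨v, l⟩
    · simp [part, swapAt]
    · have ih' := funext ih
      simp only [part, swapAt, List.length_cons, List.cons_append, swapAt_add, swapAt_mul,
        swapAt_rowOp hω]
      simp only [rowOp_mul, ih']
      ring

/-- The partition function `part` with all boundary states at the top equal to `false`. -/
def part0 (ω β : R) (γ : R → R) (l : List R) : R := part ω β γ l (l.map fun _ => false)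

theorem swapAt_map_false (ω x y : R) (xs zs : List R) (f : List Bool → R) :
    swapAt ω x y xs.length f ((xs ++ x :: y :: zs).map fun _ => false) =
      (ω * y - x) * f ((xs ++ x :: y :: zs).map fun _ => false) := by
  induction xs generalizing f with
  | nil => rfl
  | cons t xs ih => exact ih fun l => f (false :: l)

theorem part0_swap {ω : R} (hω : ω ^ 2 + ω + 1 = 0) {β : R} {γ : R → R}
    (hγ : ∀ x, β * γ x = β * (x + ω ^ 2)) {x y : R} (hxy : IsUnit (ω * y - x)) (xs zs : List R) :
    part0 ω β γ (xs ++ x :: y :: zs) = part0 ω β γ (xs ++ y :: x :: zs) := by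
  have h := swapAt_part hω hγ x y xs zs ((xs ++ x :: y :: zs).map fun _ => false)
  rw [swapAt_map_false] at h
  simpa [part0] using hxy.mul_left_cancel h

theorem part0_perm {ω : R} (hω : ω ^ 2 + ω + 1 = 0) {β : R} {γ : R → R}
    (hγ : ∀ x, β * γ x = β * (x + ω ^ 2)) {l l' : List R} (hl : l.Perm l') (pre : List R)
    (hu : l.Pairwise fun x y => IsUnit (ω * y - x) ∧ IsUnit (ω * x - y)) :
    part0 ω β γ (pre ++ l) = part0 ω β γ (pre ++ l') := by
  induction hl generalizing pre with
  | nil => rfl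
  | cons x _ ih => simpa using ih (pre ++ [x]) (List.pairwise_cons.1 hu).2
  | swap x y l =>
    have := (List.pairwise_cons.1 hu).1 x (by simp)
    exact part0_swap hω hγ this.1 _ _
  | trans h1 _ ih1 ih2 =>
    exact (ih1 pre hu).trans (ih2 pre (hu.perm h1 fun h => h.symm))

theorem rowOp_false_map_false (ω z : R) (ys : List R) (f : List Bool → R) :
    rowOp ω z ys false f (ys.map fun _ => false) =
      (ys.map fun y => ω * (z * y) - 1).prod * f (ys.map fun _ => false) := by
  induction ys generalizing f with
  | nil => simp [rowOp]
  | cons y ys ih => simp only [rowOp, ih, mul_assoc, List.map_cons, List.prod_cons]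

theorem rowOp_true_map_false_append {ω z w : R} (h : ω * (z * w) = 1) (ys : List R)
    (f : List Bool → R) :
    rowOp ω z (ys ++ [w]) true f ((ys ++ [w]).map fun _ => false) =
      (ω - 1) * (ys.map fun y => ω - z * y).prod * f ((ys.map fun _ => false) ++ [true]) := by
  induction ys generalizing f with
  | nil => simp [rowOp]
  | cons y ys ih =>
    have h0 := rowOp_false_map_false ω z (ys ++ [w]) fun l => f (true :: l)
    simp only [List.map_append, List.prod_append, List.map_cons, List.map_nil, h, sub_self,
      List.prod_cons, zero_mul, mul_zero] at h0 ih
    simp only [List.cons_append, List.map_cons, List.map_nil, List.prod_cons, rowOp, ih, h0,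
      List.map_append]
    ring

theorem rowOp_append_true (ω z w : R) (ys : List R) (h : Bool) (f : List Bool → R)
    (vs : List Bool) (hvs : vs.length = ys.length) :
    rowOp ω z (ys ++ [w]) h f (vs ++ [true]) =
      (ω - z * w) * rowOp ω z ys h (fun l => f (l ++ [true])) vs := by
  induction ys generalizing h f vs with
  | nil =>
    obtain rfl := List.length_eq_zero_iff.1 hvs
    cases h <;> simp [rowOp]
  | cons y ys ih =>
    rcases vs with _ | ⟨v, vs⟩
    · simp at hvs
    · have hvs' : vs.length = ys.length := by simpa using hvs
      cases h <;> cases v <;> simp [rowOp, ih _ _ _ hvs'] <;> ring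

theorem rowOp_congr (ω z : R) (ys : List R) (h : Bool) {f g : List Bool → R} (vs : List Bool)
    (hvs : vs.length = ys.length) (hfg : ∀ l : List Bool, l.length = ys.length → f l = g l) :
    rowOp ω z ys h f vs = rowOp ω z ys h g vs := by
  induction ys generalizing h f g vs with
  | nil => cases h <;> simp [rowOp, hfg _ hvs]
  | cons y ys ih =>
    rcases vs with _ | ⟨v, vs⟩
    · simp at hvs
    · have hvs' : vs.length = ys.length := by simpa using hvs
      have hv (b h) := ih h vs hvs' (f := fun l => f (b :: l)) (g := fun l => g (b :: l))
        fun l hl => hfg _ (by simp [hl])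
      cases h <;> cases v <;> simp [rowOp, hv]

theorem part_append_true (ω β : R) (γ : R → R) (w : R) (zs : List R) (vs : List Bool)
    (hvs : vs.length = zs.length) :
    part ω β γ (zs ++ [w]) (vs ++ [true]) =
      γ w * (zs.map fun y => ω - y * w).prod * part ω β γ zs vs := by
  induction zs generalizing vs with
  | nil =>
    obtain rfl := List.length_eq_zero_iff.1 hvs
    simp [part, rowOp, kmat]
  | cons z zs ih =>
    rcases vs with _ | ⟨v, vs⟩
    · simp at hvs
    · have hvs' : vs.length = zs.length := by simpa using hvs
      simp only [part, List.cons_append, rowOp_append_true _ _ _ _ _ _ _ hvs']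
      rw [rowOp_congr _ _ _ _ vs hvs' ih, rowOp_congr _ _ _ _ vs hvs' ih, rowOp_mul, rowOp_mul]
      simp
      ring

theorem part0_cons_cons {ω : R} (hω : ω ^ 2 + ω + 1 = 0) {β : R} {γ : R → R}
    (hγ : ∀ x, β * γ x = β * (x + ω ^ 2)) (hβ : β * β = 0) {z w : R} (h : z * w = ω)
    (zs : List R) :
    part0 ω β γ (z :: w :: zs) =
      γ z * γ w * (ω - 1) * ((zs.map fun y => ω * (z * y) - 1).prod *
        (zs.map fun y => ω * (w * y) - 1).prod) * part0 ω β γ zs := by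
  have hz := hγ z
  have hw := hγ w
  simp only [part0, part, List.map_cons, kmat, rowOp, rowOp_false_map_false, h, sub_self, zero_mul,
    zero_add]
  generalize part ω β γ zs _ = P
  generalize rowOp ω w zs true _ _ = Q
  grind

theorem part0_cons_append {ω : R} (β : R) (γ : R → R) {z w : R} (h : ω * (z * w) = 1)
    (zs : List R) :
    part0 ω β γ (z :: (zs ++ [w])) =
      γ z * γ w * (ω - 1) * ((zs.map fun y => ω - z * y).prod *
        (zs.map fun y => ω - w * y).prod) * part0 ω β γ zs := by
  simp only [part0, part, List.map_cons, kmat, rowOp_true_map_false_append h]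
  have hp : ((zs ++ [w]).map fun y => ω * (z * y) - 1).prod = 0 := by simp [h]
  rw [rowOp_false_map_false, part_append_true _ _ _ _ _ _ (by simp), hp]
  simp only [mul_comm _ w]
  ring

/-- The function `f` is given by a polynomial of degree less than `d`. -/
def IsPolyBelow (d : ℕ) (f : R → R) : Prop :=
  ∃ p : Polynomial R, (∀ m ≥ d, p.coeff m = 0) ∧ ∀ z, f z = p.eval z

theorem IsPolyBelow.add {d : ℕ} {f g : R → R} (hf : IsPolyBelow d f) (hg : IsPolyBelow d g) :
    IsPolyBelow d fun z => f z + g z := by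
  obtain ⟨p, hp, hp'⟩ := hf
  obtain ⟨q, hq, hq'⟩ := hg
  exact ⟨p + q, fun m hm => by simp [hp m hm, hq m hm], fun z => by simp [hp', hq']⟩

theorem IsPolyBelow.const_mul {d : ℕ} {f : R → R} (hf : IsPolyBelow d f) (c : R) :
    IsPolyBelow d fun z => c * f z := by
  obtain ⟨p, hp, hp'⟩ := hf
  exact ⟨Polynomial.C c * p, fun m hm => by simp [hp m hm], fun z => by simp [hp']⟩

theorem IsPolyBelow.linear_mul {d : ℕ} {f : R → R} (hf : IsPolyBelow d f) (a b : R) :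
    IsPolyBelow (d + 1) fun z => (a * z + b) * f z := by
  obtain ⟨p, hp, hp'⟩ := hf
  refine ⟨(Polynomial.C a * Polynomial.X + Polynomial.C b) * p, fun m hm => ?_,
    fun z => by simp [hp']⟩
  obtain ⟨m, rfl⟩ := Nat.exists_eq_succ_of_ne_zero (n := m) (by omega)
  rw [add_mul, mul_assoc, Polynomial.coeff_add, Polynomial.coeff_C_mul, Polynomial.coeff_C_mul,
    Polynomial.coeff_X_mul, hp m (by omega), hp _ (by omega)]
  simp

theorem isPolyBelow_const (c : R) : IsPolyBelow 1 fun _ => c :=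
  ⟨Polynomial.C c, fun m hm => by simp [Polynomial.coeff_C, show m ≠ 0 by omega], by simp⟩

theorem isPolyBelow_rowOp_false (ω : R) (ys : List R) (f : List Bool → R) :
    IsPolyBelow (ys.length + 1) fun z => rowOp ω z ys false f (ys.map fun _ => false) := by
  induction ys generalizing f with
  | nil => simpa [rowOp] using isPolyBelow_const (f [])
  | cons y ys ih =>
    convert (ih fun l => f (false :: l)).linear_mul (ω * y) (-1) using 2
    · simp
    · simp only [List.map_cons, rowOp]
      ring

theorem isPolyBelow_rowOp_true (ω : R) (ys : List R) (f : List Bool → R) :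
    IsPolyBelow ys.length fun z => rowOp ω z ys true f (ys.map fun _ => false) := by
  induction ys generalizing f with
  | nil => exact ⟨0, by simp, by simp [rowOp]⟩
  | cons y ys ih =>
    convert ((ih fun l => f (false :: l)).linear_mul (-y) ω).add
      ((isPolyBelow_rowOp_false ω ys fun l => f (true :: l)).const_mul (ω - 1)) using 2
    · simp
    · simp only [List.map_cons, rowOp]
      ring

theorem isPolyBelow_part0_even (ω : R) (zs : List R) :
    IsPolyBelow zs.length fun z => part0 ω 0 (fun _ => 1) (z :: zs) := by
  simpa [part0, part, kmat] using isPolyBelow_rowOp_true ω zs (part ω 0 (fun _ => 1) zs)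

theorem isPolyBelow_part0_odd (ω β : R) (zs : List R) :
    IsPolyBelow (zs.length + 1) fun z => part0 ω β (fun x => x + ω ^ 2) (z :: zs) := by
  convert ((isPolyBelow_rowOp_false ω zs (part ω β (fun x => x + ω ^ 2) zs)).const_mul β).add
    ((isPolyBelow_rowOp_true ω zs (part ω β (fun x => x + ω ^ 2) zs)).linear_mul 1 (ω ^ 2)) using 2
  simp [part0, part, kmat]

theorem continuous_rowOp [TopologicalSpace R] [IsTopologicalRing R] {T : Type*}
    [TopologicalSpace T] (ω : R) {z : T → R} (hz : Continuous z) (ys : List (T → R))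
    (hys : ∀ y ∈ ys, Continuous y) (h : Bool) {f : T → List Bool → R}
    (hf : ∀ l, Continuous fun t => f t l) (vs : List Bool) :
    Continuous fun t => rowOp ω (z t) (ys.map fun y => y t) h (f t) vs := by
  induction ys generalizing h f vs with
  | nil => cases h <;> simp [rowOp, hf, continuous_const]
  | cons y ys ih =>
    rcases vs with _ | ⟨v, vs⟩
    · simp [rowOp, continuous_const]
    · have hy : Continuous y := hys y (by simp)
      have hr (b h) := ih (fun y hy => hys y (by simp [hy])) h (f := fun t l => f t (b :: l))
        (fun l => hf _) vs
      have h1 := hr false false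
      have h2 := hr false true
      have h3 := hr true false
      have h4 := hr true true
      cases h <;> cases v <;> simp only [rowOp, List.map_cons] <;> fun_prop

theorem continuous_part [TopologicalSpace R] [IsTopologicalRing R] {T : Type*}
    [TopologicalSpace T] (ω β : R) {γ : R → R} (hγ : Continuous γ) (zs : List (T → R))
    (hzs : ∀ z ∈ zs, Continuous z) (vs : List Bool) :
    Continuous fun t => part ω β γ (zs.map fun z => z t) vs := by
  induction zs generalizing vs with
  | nil => simp [part, continuous_const]
  | cons z zs ih =>
    rcases vs with _ | ⟨v, vs⟩
    · simp [part, continuous_const]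
    · have hz : Continuous z := hzs z (by simp)
      have hr (h) := continuous_rowOp ω hz zs (fun y hy => hzs y (by simp [hy])) h
        (fun l => ih (fun y hy => hzs y (by simp [hy])) l) vs
      have h1 := hr false
      have h2 := hr true
      cases v <;> simp only [part, kmat, List.map_cons] <;> fun_prop

end SixVertex

section Evaluations

open TrivSqZeroExt

/-- The partition function of triangles with exactly one nonzero diagonal entry: the coefficient
of `ε` in the partition function over the dual numbers whose nonzero diagonal entries have
weight `ε`. -/
def oddPart (ω : ℂ) (l : List ℂ) : ℂ :=
  (part0 (inlHom ℂ ℂ ω) DualNumber.eps (fun x => x + inlHom ℂ ℂ ω ^ 2) (l.map (inlHom ℂ ℂ))).snd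

/-- The partition function of triangles whose diagonal entries are all zero. -/
def evenPart (ω : ℂ) (l : List ℂ) : ℂ := part0 ω 0 (fun _ => 1) l

variable {ω : ℂ}

theorem snd_inlHom_mul (a : ℂ) (x : DualNumber ℂ) : (inlHom ℂ ℂ a * x).snd = a * x.snd := by
  simp [inlHom]

theorem inlHom_root (hω : ω ^ 2 + ω + 1 = 0) :
    inlHom ℂ ℂ ω ^ 2 + inlHom ℂ ℂ ω + 1 = 0 := by
  simpa only [map_add, map_pow, map_one, map_zero] using congrArg (inlHom ℂ ℂ) hω

theorem norm_root (hω : ω ^ 2 + ω + 1 = 0) : ‖ω‖ = 1 := by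
  have h : ω ^ 3 = 1 := by linear_combination (ω - 1) * hω
  exact Complex.norm_eq_one_of_pow_eq_one h (by norm_num)

theorem root_mul_sub_ne_zero (hω : ω ^ 2 + ω + 1 = 0) {x y : ℂ} (h : ‖x‖ ≠ ‖y‖) :
    ω * y - x ≠ 0 := by
  intro h0
  apply h
  rw [← sub_eq_zero.1 h0, norm_mul, norm_root hω, one_mul]

theorem evenPart_perm (hω : ω ^ 2 + ω + 1 = 0) {l l' : List ℂ} (hl : l.Perm l') (pre : List ℂ)
    (hu : (l.map (‖·‖)).Nodup) : evenPart ω (pre ++ l) = evenPart ω (pre ++ l') := by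
  refine part0_perm hω (by simp) hl pre ((List.pairwise_map.1 hu).imp fun h => ?_)
  exact ⟨(root_mul_sub_ne_zero hω h).isUnit, (root_mul_sub_ne_zero hω h.symm).isUnit⟩

theorem oddPart_perm (hω : ω ^ 2 + ω + 1 = 0) {l l' : List ℂ} (hl : l.Perm l') (pre : List ℂ)
    (hu : (l.map (‖·‖)).Nodup) : oddPart ω (pre ++ l) = oddPart ω (pre ++ l') := by
  have := part0_perm (inlHom_root hω) (β := DualNumber.eps)
    (γ := fun x => x + inlHom ℂ ℂ ω ^ 2) (fun _ => rfl) (hl.map (inlHom ℂ ℂ))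
    (pre.map (inlHom ℂ ℂ)) ?_
  · simp only [oddPart, List.map_append, this]
  · refine List.pairwise_map.2 ((List.pairwise_map.1 hu).imp fun h => ?_)
    simp only [← map_mul, ← map_sub]
    exact ⟨(root_mul_sub_ne_zero hω h).isUnit.map _, (root_mul_sub_ne_zero hω h.symm).isUnit.map _⟩

theorem evenPart_cons_cons (hω : ω ^ 2 + ω + 1 = 0) {z w : ℂ} (h : z * w = ω) (zs : List ℂ) :
    evenPart ω (z :: w :: zs) =
      (ω - 1) * ((zs.map fun y => ω * (z * y) - 1).prod *
        (zs.map fun y => ω * (w * y) - 1).prod) * evenPart ω zs := by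
  simpa [evenPart] using part0_cons_cons hω (β := 0) (γ := fun _ => 1) (by simp) (by simp) h zs

theorem evenPart_cons_append {z w : ℂ} (h : ω * (z * w) = 1) (zs : List ℂ) :
    evenPart ω (z :: (zs ++ [w])) =
      (ω - 1) * ((zs.map fun y => ω - z * y).prod * (zs.map fun y => ω - w * y).prod) *
        evenPart ω zs := by
  simpa [evenPart] using part0_cons_append 0 (fun _ => 1) h zs

theorem oddPart_cons_cons (hω : ω ^ 2 + ω + 1 = 0) {z w : ℂ} (h : z * w = ω) (zs : List ℂ) :
    oddPart ω (z :: w :: zs) =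
      (z + ω ^ 2) * (w + ω ^ 2) * (ω - 1) * ((zs.map fun y => ω * (z * y) - 1).prod *
        (zs.map fun y => ω * (w * y) - 1).prod) * oddPart ω zs := by
  have := part0_cons_cons (inlHom_root hω) (β := DualNumber.eps)
    (γ := fun x => x + inlHom ℂ ℂ ω ^ 2) (fun _ => rfl) DualNumber.eps_mul_eps
    (z := inlHom ℂ ℂ z) (w := inlHom ℂ ℂ w) (by rw [← map_mul, h]) (zs.map (inlHom ℂ ℂ))
  rw [oddPart, oddPart, ← snd_inlHom_mul, List.map_cons, List.map_cons, this]
  simp only [map_mul, map_add, map_sub, map_pow, map_one, map_list_prod, List.map_map,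
    Function.comp_def]

theorem oddPart_cons_append {z w : ℂ} (h : ω * (z * w) = 1) (zs : List ℂ) :
    oddPart ω (z :: (zs ++ [w])) =
      (z + ω ^ 2) * (w + ω ^ 2) * (ω - 1) * ((zs.map fun y => ω - z * y).prod *
        (zs.map fun y => ω - w * y).prod) * oddPart ω zs := by
  have := part0_cons_append (ω := inlHom ℂ ℂ ω) DualNumber.eps
    (fun x => x + inlHom ℂ ℂ ω ^ 2) (z := inlHom ℂ ℂ z) (w := inlHom ℂ ℂ w)
    (by rw [← map_mul, ← map_mul, h, map_one]) (zs.map (inlHom ℂ ℂ))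
  rw [oddPart, oddPart, ← snd_inlHom_mul, List.map_cons, List.map_append, List.map_cons,
    List.map_nil, this]
  simp only [map_mul, map_add, map_sub, map_pow, map_one, map_list_prod, List.map_map,
    Function.comp_def]

theorem isPolyBelow_evenPart (ω : ℂ) (zs : List ℂ) :
    IsPolyBelow zs.length fun z => evenPart ω (z :: zs) :=
  isPolyBelow_part0_even ω zs

theorem isPolyBelow_oddPart (ω : ℂ) (zs : List ℂ) :
    IsPolyBelow (zs.length + 1) fun z => oddPart ω (z :: zs) := by
  obtain ⟨p, hp, hp'⟩ := isPolyBelow_part0_odd (inlHom ℂ ℂ ω) DualNumber.eps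
    (zs.map (inlHom ℂ ℂ))
  refine ⟨∑ i ∈ range (zs.length + 1), Polynomial.monomial i (p.coeff i).snd, fun m hm => ?_,
    fun z => ?_⟩
  · simp only [Polynomial.finsetSum_coeff, Polynomial.coeff_monomial]
    refine sum_eq_zero fun i hi => if_neg ?_
    have := mem_range.1 hi
    omega
  · have hd : p.natDegree < zs.length + 1 := by
      refine Nat.lt_succ_of_le (Polynomial.natDegree_le_iff_coeff_eq_zero.2 fun m hm => hp m ?_)
      simpa using hm
    simp only [oddPart, List.map_cons, hp', Polynomial.eval_eq_sum_range' hd,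
      Polynomial.eval_finsetSum, Polynomial.eval_monomial, snd_sum]
    refine sum_congr rfl fun i _ => ?_
    rw [← map_pow, mul_comm, snd_inlHom_mul, mul_comm]

theorem IsPolyBelow.reflect {d : ℕ} {f : ℂ → ℂ} (hf : IsPolyBelow (d + 1) f) :
    ∃ g, IsPolyBelow (d + 1) g ∧ ∀ z ≠ 0, g z = z ^ d * f z⁻¹ := by
  obtain ⟨p, hp, hp'⟩ := hf
  have hd : p.natDegree ≤ d := Polynomial.natDegree_le_iff_coeff_eq_zero.2 fun m hm => hp m hm
  refine ⟨fun z => (p.reflect d).eval z, ⟨p.reflect d, fun m hm => ?_, fun _ => rfl⟩,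
    fun z hz => ?_⟩
  · rw [Polynomial.coeff_reflect, Polynomial.revAt_eq_self_of_lt (by omega), hp m hm]
  · have : Invertible z⁻¹ := invertibleOfNonzero (inv_ne_zero hz)
    have h := Polynomial.eval₂_reflect_mul_pow (RingHom.id ℂ) z⁻¹ d p hd
    rw [hp', ← Polynomial.eval₂_id, ← h, _root_.invOf_eq_inv, inv_inv, Polynomial.eval₂_id,
      mul_comm, mul_assoc, ← mul_pow, inv_mul_cancel₀ hz, one_pow, mul_one]

theorem IsPolyBelow.eq_zero {d : ℕ} {f : ℂ → ℂ} (hf : IsPolyBelow d f) (s : Finset ℂ)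
    (hs : d ≤ s.card) (h : ∀ x ∈ s, f x = 0) (z : ℂ) : f z = 0 := by
  obtain ⟨p, hp, hp'⟩ := hf
  have : p = 0 := by
    refine Polynomial.eq_zero_of_degree_lt_of_eval_finset_eq_zero s ?_ fun x hx => ?_
    · exact (Polynomial.degree_lt_iff_coeff_zero _ _).2 fun m hm => hp m (hs.trans hm)
    · rw [← hp', h x hx]
  simp [hp', this]

theorem prod_map_sub_inv {z : ℂ} (hz : z ≠ 0) (l : List ℂ) (hl : ∀ y ∈ l, y ≠ 0) :
    (l.map fun y => ω - z⁻¹ * y⁻¹).prod * (z ^ l.length * l.prod) =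
      (l.map fun y => ω * (z * y) - 1).prod := by
  induction l with
  | nil => simp
  | cons y l ih =>
    have hy : y ≠ 0 := hl y (by simp)
    have h : (ω - z⁻¹ * y⁻¹) * (z * y) = ω * (z * y) - 1 := by field_simp
    rw [List.map_cons, List.map_cons, List.prod_cons, List.prod_cons, List.prod_cons,
      List.length_cons, ← ih fun y hy => hl y (by simp [hy]), ← h]
    ring

theorem prod_map_inv_sub {z : ℂ} (hz : z ≠ 0) (l : List ℂ) (hl : ∀ y ∈ l, y ≠ 0) :
    (l.map fun y => ω * (z⁻¹ * y⁻¹) - 1).prod * (z ^ l.length * l.prod) =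
      (l.map fun y => ω - z * y).prod := by
  induction l with
  | nil => simp
  | cons y l ih =>
    have hy : y ≠ 0 := hl y (by simp)
    have h : (ω * (z⁻¹ * y⁻¹) - 1) * (z * y) = ω - z * y := by field_simp
    rw [List.map_cons, List.map_cons, List.prod_cons, List.prod_cons, List.prod_cons,
      List.length_cons, ← ih fun y hy => hl y (by simp [hy]), ← h]
    ring

/-- The difference of the two sides of the identity that expresses a symmetrized odd partition
function with parameters `z :: l` through the even partition function with parameters
`z :: -1 :: l`. -/
noncomputable def defect (ω z : ℂ) (l : List ℂ) : ℂ :=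
  (ω - 1) * ((1 + ω ^ 2 * z) * (l.map fun y => 1 + ω ^ 2 * y).prod * oddPart ω (z :: l) +
    (z + ω ^ 2) * (l.map fun y => y + ω ^ 2).prod * (z ^ l.length * l.prod ^ l.length) *
      oddPart ω (z⁻¹ :: l.map fun y => y⁻¹)) +
  ω * (z + 1) * (l.map fun y => y + 1).prod * evenPart ω (z :: -1 :: l)

/-- The parameters in `l` have pairwise distinct norms, all greater than one. -/
def IsGeneric (l : List ℂ) : Prop := (l.map (‖·‖)).Nodup ∧ ∀ x ∈ l, 1 < ‖x‖

theorem IsGeneric.perm {l l' : List ℂ} (h : IsGeneric l) (hl : l.Perm l') : IsGeneric l' :=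
  ⟨(hl.map _).nodup_iff.1 h.1, fun x hx => h.2 x (hl.mem_iff.2 hx)⟩

theorem IsGeneric.of_cons {x : ℂ} {l : List ℂ} (h : IsGeneric (x :: l)) : IsGeneric l :=
  ⟨(List.nodup_cons.1 h.1).2, fun y hy => h.2 y (by simp [hy])⟩

theorem IsGeneric.ne_zero {l : List ℂ} (h : IsGeneric l) {x : ℂ} (hx : x ∈ l) : x ≠ 0 := by
  rintro rfl
  have := h.2 0 hx
  norm_num at this

theorem IsGeneric.nodup_norm_neg_one_cons {l : List ℂ} (h : IsGeneric l) :
    ((-1 :: l).map (‖·‖)).Nodup := by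
  refine List.nodup_cons.2 ⟨fun hm => ?_, h.1⟩
  obtain ⟨x, hx, hx'⟩ := List.mem_map.1 hm
  have := h.2 x hx
  norm_num at hx'
  linarith

theorem IsGeneric.nodup_norm_inv {l : List ℂ} (h : IsGeneric l) :
    ((l.map fun y => y⁻¹).map (‖·‖)).Nodup := by
  have := h.1.map inv_injective
  simpa [Function.comp_def] using this

theorem defect_perm (hω : ω ^ 2 + ω + 1 = 0) {l l' : List ℂ} (hl : l.Perm l') (h : IsGeneric l)
    (z : ℂ) : defect ω z l = defect ω z l' := by
  have h1 : oddPart ω (z :: l) = oddPart ω (z :: l') := oddPart_perm hω hl [z] h.1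
  have h2 : oddPart ω (z⁻¹ :: l.map fun y => y⁻¹) = oddPart ω (z⁻¹ :: l'.map fun y => y⁻¹) :=
    oddPart_perm hω (hl.map _) [z⁻¹] h.nodup_norm_inv
  have h3 : evenPart ω (z :: -1 :: l) = evenPart ω (z :: -1 :: l') :=
    evenPart_perm hω (hl.cons _) [z] h.nodup_norm_neg_one_cons
  rw [defect, defect, h1, h2, h3, hl.length_eq, hl.prod_eq,
    (hl.map fun y => 1 + ω ^ 2 * y).prod_eq, (hl.map fun y => y + ω ^ 2).prod_eq,
    (hl.map fun y => y + 1).prod_eq]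

theorem defect_combination {ω z w t z' w' a b A B O O' E p K' K S : ℂ} {k : ℕ}
    (hz : z * (z' + ω ^ 2) = 1 + ω ^ 2 * z) (hw : w * (w' + ω ^ 2) = 1 + ω ^ 2 * w)
    (hab : (z + 1) * (w + 1) * (a * b) =
      (1 + ω ^ 2 * z) * (1 + ω ^ 2 * w) * ((z + ω ^ 2) * (w + ω ^ 2)))
    (h : (ω - 1) * ((1 + ω ^ 2 * t) * K' * O +
      (t + ω ^ 2) * K * (t ^ (2 * k) * p ^ (2 * k)) * O') + ω * (t + 1) * S * E = 0) :
    (ω - 1) *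
        ((1 + ω ^ 2 * z) * ((1 + ω ^ 2 * w) * ((1 + ω ^ 2 * t) * K')) *
            ((z + ω ^ 2) * (w + ω ^ 2) * (ω - 1) *
                (A * (z ^ (2 * k + 1) * (t * p)) * (B * (w ^ (2 * k + 1) * (t * p)))) * O) +
          (z + ω ^ 2) * ((w + ω ^ 2) * ((t + ω ^ 2) * K)) *
              (z ^ (2 * k + 1 + 1) * (w * (t * p)) ^ (2 * k + 1 + 1)) *
            ((z' + ω ^ 2) * (w' + ω ^ 2) * (ω - 1) * (A * B) * O')) +
      ω * (z + 1) * ((w + 1) * ((t + 1) * S)) *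
        ((ω - 1) * (a * (A * (z ^ (2 * k + 1) * (t * p))) *
          (b * (B * (w ^ (2 * k + 1) * (t * p))))) * E) = 0 := by
  have hzw : z * (z' + ω ^ 2) * (w * (w' + ω ^ 2)) = (1 + ω ^ 2 * z) * (1 + ω ^ 2 * w) := by
    rw [hz, hw]
  linear_combination ((ω - 1) * A * B * z ^ (2 * k + 1) * w ^ (2 * k + 1) * (t * p) ^ 2 *
      ((1 + ω ^ 2 * z) * (1 + ω ^ 2 * w) * ((z + ω ^ 2) * (w + ω ^ 2)))) * h +
    ((ω - 1) * (t + ω ^ 2) * K * t ^ (2 * k) * p ^ (2 * k) * O' * (ω - 1) * (z + ω ^ 2) *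
      (w + ω ^ 2) * A * B * z ^ (2 * k + 1) * w ^ (2 * k + 1) * (t * p) ^ 2) * hzw +
    (ω * (t + 1) * S * E * (ω - 1) * A * B * z ^ (2 * k + 1) * w ^ (2 * k + 1) *
      (t * p) ^ 2) * hab

theorem defect_eq_zero_of_mul_eq_root (hω : ω ^ 2 + ω + 1 = 0) {z w t : ℂ} {l : List ℂ} {k : ℕ}
    (hl : l.length = 2 * k) (hg : IsGeneric (w :: t :: l)) (hzw : z * w = ω)
    (h : defect ω t l = 0) : defect ω z (w :: t :: l) = 0 := by
  have e3 : ω ^ 3 = 1 := by linear_combination (ω - 1) * hω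
  have hω0 : ω ≠ 0 := by rintro rfl; norm_num at hω
  have hz : z ≠ 0 := left_ne_zero_of_mul (hzw ▸ hω0)
  have hw : w ≠ 0 := right_ne_zero_of_mul (hzw ▸ hω0)
  have h0 : ∀ y ∈ t :: l, y ≠ 0 := fun y hy => hg.of_cons.ne_zero hy
  have hE1 : evenPart ω (z :: -1 :: w :: t :: l) = evenPart ω (z :: w :: -1 :: t :: l) :=
    evenPart_perm hω (List.Perm.swap _ _ _) [z] hg.nodup_norm_neg_one_cons
  have hE2 : evenPart ω (-1 :: t :: l) = evenPart ω (t :: -1 :: l) :=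
    evenPart_perm hω (List.Perm.swap _ _ _) [] hg.of_cons.nodup_norm_neg_one_cons
  have hO : oddPart ω (z⁻¹ :: (w :: t :: l).map fun y => y⁻¹) =
      oddPart ω (z⁻¹ :: (((t :: l).map fun y => y⁻¹) ++ [w⁻¹])) :=
    oddPart_perm hω (List.perm_append_singleton _ _).symm [z⁻¹] hg.nodup_norm_inv
  have hA := prod_map_sub_inv (ω := ω) hz (t :: l) h0
  have hB := prod_map_sub_inv (ω := ω) hw (t :: l) h0
  have hzw' : ω * (z⁻¹ * w⁻¹) = 1 := by rw [← mul_inv, hzw, mul_inv_cancel₀ hω0]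
  have hz' : z * (z⁻¹ + ω ^ 2) = 1 + ω ^ 2 * z := by field_simp
  have hw' : w * (w⁻¹ + ω ^ 2) = 1 + ω ^ 2 * w := by field_simp
  have hk : (1 + ω ^ 2 * z) * (1 + ω ^ 2 * w) = ω ^ 2 * ((z + 1) * (w + 1)) := by
    linear_combination (ω ^ 4 - ω ^ 2) * hzw + (ω ^ 2 - 1) * e3
  rw [defect, oddPart_cons_cons hω hzw, hO, oddPart_cons_append hzw', hE1,
    evenPart_cons_cons hω hzw, hE2]
  rw [defect] at h
  have hm (u : ℂ) : ((-1 :: t :: l).map fun y => ω * (u * y) - 1).prod =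
      (ω * (u * -1) - 1) * ((t :: l).map fun y => ω * (u * y) - 1).prod := List.prod_cons
  rw [hm z, hm w, List.map_map, List.map_map, ← hA, ← hB]
  simp only [Function.comp_def, List.map_cons, List.prod_cons, List.length_cons, hl] at h ⊢
  refine defect_combination hz' hw' ?_ h
  rw [hk]
  grind

theorem defect_eq_zero_of_mul_mul_eq_one (hω : ω ^ 2 + ω + 1 = 0) {z w t : ℂ} {l : List ℂ} {k : ℕ}
    (hl : l.length = 2 * k) (hg : IsGeneric (w :: t :: l)) (hzw : ω * (z * w) = 1)
    (h : defect ω t l = 0) : defect ω z (w :: t :: l) = 0 := by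
  have e3 : ω ^ 3 = 1 := by linear_combination (ω - 1) * hω
  have hω0 : ω ≠ 0 := by rintro rfl; norm_num at hω
  have hz : z ≠ 0 := left_ne_zero_of_mul (right_ne_zero_of_mul (hzw ▸ one_ne_zero))
  have hw : w ≠ 0 := right_ne_zero_of_mul (right_ne_zero_of_mul (hzw ▸ one_ne_zero))
  have h0 : ∀ y ∈ t :: l, y ≠ 0 := fun y hy => hg.of_cons.ne_zero hy
  have hE1 : evenPart ω (z :: -1 :: w :: t :: l) = evenPart ω (z :: ((-1 :: t :: l) ++ [w])) :=
    evenPart_perm hω ((List.Perm.swap _ _ _).trans (List.perm_append_singleton _ _).symm) [z]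
      hg.nodup_norm_neg_one_cons
  have hE2 : evenPart ω (-1 :: t :: l) = evenPart ω (t :: -1 :: l) :=
    evenPart_perm hω (List.Perm.swap _ _ _) [] hg.of_cons.nodup_norm_neg_one_cons
  have hO : oddPart ω (z :: w :: t :: l) = oddPart ω (z :: ((t :: l) ++ [w])) :=
    oddPart_perm hω (List.perm_append_singleton _ _).symm [z] hg.1
  have hA := prod_map_inv_sub (ω := ω) hz (t :: l) h0
  have hB := prod_map_inv_sub (ω := ω) hw (t :: l) h0
  have hzw' : z⁻¹ * w⁻¹ = ω := by rw [← mul_inv, inv_eq_of_mul_eq_one_left hzw]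
  have hz' : z * (z⁻¹ + ω ^ 2) = 1 + ω ^ 2 * z := by field_simp
  have hw' : w * (w⁻¹ + ω ^ 2) = 1 + ω ^ 2 * w := by field_simp
  have hk : (z + ω ^ 2) * (w + ω ^ 2) = ω ^ 2 * ((z + 1) * (w + 1)) := by
    grind
  have hO' : oddPart ω (z⁻¹ :: (w :: t :: l).map fun y => y⁻¹) = _ :=
    oddPart_cons_cons hω hzw' ((t :: l).map fun y => y⁻¹)
  rw [defect, hO, oddPart_cons_append hzw, hO', hE1, evenPart_cons_append hzw, hE2]
  rw [defect] at h
  have hm (u : ℂ) : ((-1 :: t :: l).map fun y => ω - u * y).prod =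
      (ω - u * -1) * ((t :: l).map fun y => ω - u * y).prod := List.prod_cons
  rw [hm z, hm w, List.map_map, List.map_map, ← hA, ← hB]
  simp only [Function.comp_def, List.map_cons, List.prod_cons, List.length_cons, hl] at h ⊢
  refine defect_combination hz' hw' ?_ h
  rw [hk]
  grind

theorem exists_isPolyBelow_defect (ω : ℂ) (l : List ℂ) :
    ∃ g, IsPolyBelow (l.length + 2) g ∧ ∀ z ≠ 0, g z = defect ω z l := by
  have h1 := ((isPolyBelow_oddPart ω l).linear_mul (ω ^ 2) 1).const_mul
    ((ω - 1) * (l.map fun y => 1 + ω ^ 2 * y).prod)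
  obtain ⟨r, hr, hr'⟩ := (isPolyBelow_oddPart ω (l.map fun y => y⁻¹)).reflect
  have h2 := (hr.linear_mul 1 (ω ^ 2)).const_mul
    ((ω - 1) * (l.map fun y => y + ω ^ 2).prod * l.prod ^ l.length)
  have h3 := ((isPolyBelow_evenPart ω (-1 :: l)).linear_mul 1 1).const_mul
    (ω * (l.map fun y => y + 1).prod)
  rw [List.length_map] at h2
  refine ⟨_, (h1.add h2).add h3, fun z hz => ?_⟩
  rw [hr' z hz, List.length_map, defect]
  ring

theorem two_mul_length_le_card_image (hω : ω ^ 2 + ω + 1 = 0) {l : List ℂ} (h : IsGeneric l) :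
    2 * l.length ≤
      (l.toFinset.image (fun w => ω / w) ∪ l.toFinset.image fun w => ω ^ 2 / w).card := by
  have hω0 : ω ≠ 0 := by rintro rfl; norm_num at hω
  have hω1 : ω ≠ 1 := by rintro rfl; norm_num at hω
  have hl : l.toFinset.card = l.length := List.toFinset_card_of_nodup h.1.of_map
  have hinj (c : ℂ) (hc : c ≠ 0) : Function.Injective fun w => c / w := fun x y hxy => by
    simpa [div_eq_mul_inv, hc] using hxy
  rw [card_union_of_disjoint, card_image_of_injective _ (hinj _ hω0),
    card_image_of_injective _ (hinj _ (pow_ne_zero 2 hω0)), hl, two_mul]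
  rw [disjoint_left]
  intro x hx hx'
  simp only [mem_image, List.mem_toFinset] at hx hx'
  obtain ⟨u, hu, rfl⟩ := hx
  obtain ⟨v, hv, huv⟩ := hx'
  have hn := congrArg (‖·‖) huv
  simp only [norm_div, norm_pow, norm_root hω, one_pow, one_div, inv_inj] at hn
  obtain rfl := List.inj_on_of_nodup_map h.1 hv hu hn
  have := h.ne_zero hu
  field_simp at huv
  exact hω1 huv

theorem defect_eq_zero (hω : ω ^ 2 + ω + 1 = 0) (k : ℕ) {l : List ℂ} (hl : l.length = 2 * k)
    (h : IsGeneric l) {z : ℂ} (hz : z ≠ 0) : defect ω z l = 0 := by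
  have e3 : ω ^ 3 = 1 := by linear_combination (ω - 1) * hω
  have hω0 : ω ≠ 0 := by rintro rfl; norm_num at hω
  induction k generalizing l z with
  | zero =>
    obtain rfl := List.length_eq_zero_iff.1 hl
    simp only [defect, oddPart, evenPart, part0, List.map_cons, List.map_nil, part, kmat, rowOp,
      cond_true, cond_false, mul_one, mul_zero, add_zero, zero_add, DualNumber.snd_eps,
      List.prod_nil, List.length_nil, pow_zero, zero_mul]
    linear_combination (ω - 1) * (z + 1) * hω
  | succ k ih =>
    obtain ⟨g, hg, hg'⟩ := exists_isPolyBelow_defect ω l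
    rw [← hg' z hz]
    refine hg.eq_zero _ (le_trans (by omega) (two_mul_length_le_card_image hω h)) ?_ z
    have key (w : ℂ) (hw : w ∈ l) :
        (∀ x, x * w = ω → g x = 0) ∧ (∀ x, ω * (x * w) = 1 → g x = 0) := by
      have hp := List.perm_cons_erase hw
      obtain ⟨t, l', hl'⟩ : ∃ t l', l.erase w = t :: l' := by
        refine List.exists_cons_of_length_pos ?_
        rw [List.length_erase_of_mem hw]
        omega
      rw [hl'] at hp
      have hlen : l'.length = 2 * k := by
        have := hp.length_eq
        simp only [List.length_cons] at this
        omega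
      have hgen := h.perm hp
      have h0 : defect ω t l' = 0 := ih hlen hgen.of_cons.of_cons (hgen.ne_zero (by simp))
      constructor
      · intro x hx
        have hx0 : x ≠ 0 := left_ne_zero_of_mul (hx ▸ hω0)
        rw [hg' x hx0, defect_perm hω hp h]
        exact defect_eq_zero_of_mul_eq_root hω hlen hgen hx h0
      · intro x hx
        have hx0 : x ≠ 0 := left_ne_zero_of_mul (right_ne_zero_of_mul (hx ▸ one_ne_zero))
        rw [hg' x hx0, defect_perm hω hp h]
        exact defect_eq_zero_of_mul_mul_eq_one hω hlen hgen hx h0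
    intro x hx
    simp only [mem_union, mem_image, List.mem_toFinset] at hx
    rcases hx with ⟨w, hw, rfl⟩ | ⟨w, hw, rfl⟩
    · exact (key w hw).1 _ (div_mul_cancel₀ _ (h.ne_zero hw))
    · refine (key w hw).2 _ ?_
      rw [div_mul_cancel₀ _ (h.ne_zero hw)]
      linear_combination e3

theorem continuous_evenPart {T : Type*} [TopologicalSpace T] (ω : ℂ) (zs : List (T → ℂ))
    (hzs : ∀ z ∈ zs, Continuous z) : Continuous fun t => evenPart ω (zs.map fun z => z t) := by
  simp only [evenPart, part0, List.map_const', List.length_map]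
  exact continuous_part ω 0 continuous_const zs hzs _

theorem continuous_oddPart {T : Type*} [TopologicalSpace T] (ω : ℂ) (zs : List (T → ℂ))
    (hzs : ∀ z ∈ zs, Continuous z) : Continuous fun t => oddPart ω (zs.map fun z => z t) := by
  have h := continuous_part (inlHom ℂ ℂ ω) DualNumber.eps
    (γ := fun x => x + inlHom ℂ ℂ ω ^ 2) (continuous_id.add continuous_const)
    (zs.map fun z t => inlHom ℂ ℂ (z t))
    (by
      intro z hz
      obtain ⟨y, hy, rfl⟩ := List.mem_map.1 hz
      exact continuous_inl.comp (hzs y hy)) (List.replicate zs.length false)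
  simp only [oddPart, part0]
  simp only [List.map_map] at h ⊢
  simp only [Function.comp_def, List.map_const'] at h ⊢
  exact TrivSqZeroExt.continuous_snd.comp h

theorem continuous_defect {T : Type*} [TopologicalSpace T] (ω : ℂ) (zs : List (T → ℂ))
    (hzs : ∀ z ∈ zs, Continuous z) (h0 : ∀ z ∈ zs, ∀ t, z t ≠ 0) :
    Continuous fun t => defect ω 1 (zs.map fun z => z t) := by
  have h1 := continuous_oddPart ω ((fun _ => 1) :: zs) (by simpa [continuous_const] using hzs)
  have h2 := continuous_oddPart ω ((fun _ => 1⁻¹) :: zs.map fun z t => (z t)⁻¹) (by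
    simp only [List.mem_cons, List.mem_map, forall_eq_or_imp, continuous_const, true_and]
    rintro _ ⟨z, hz, rfl⟩
    exact (hzs z hz).inv₀ (h0 z hz))
  have h3 := continuous_evenPart ω ((fun _ => 1) :: (fun _ => -1) :: zs)
    (by simpa [continuous_const] using hzs)
  have h4 : Continuous fun t => (zs.map fun z => 1 + ω ^ 2 * z t).prod :=
    continuous_list_prod zs fun z hz => continuous_const.add (continuous_const.mul (hzs z hz))
  have h5 : Continuous fun t => (zs.map fun z => z t + ω ^ 2).prod :=
    continuous_list_prod zs fun z hz => (hzs z hz).add continuous_const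
  have h6 : Continuous fun t => (zs.map fun z => z t + 1).prod :=
    continuous_list_prod zs fun z hz => (hzs z hz).add continuous_const
  have h7 : Continuous fun t => (zs.map fun z => z t).prod := continuous_list_prod zs hzs
  simp only [List.map_cons, List.map_map, Function.comp_def] at h1 h2 h3
  simp only [defect, List.map_map, Function.comp_def, List.length_map]
  fun_prop

theorem defect_replicate_one (hω : ω ^ 2 + ω + 1 = 0) (n : ℕ) :
    defect ω 1 (List.replicate (2 * n) 1) = 0 := by
  let zs : List (ℝ → ℂ) := (List.range (2 * n)).map fun (j : ℕ) t => 1 + ((j + 1) * |t| : ℝ)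
  have hnorm (j : ℕ) (t : ℝ) : ‖(1 + ((j + 1) * |t| : ℝ) : ℂ)‖ = 1 + (j + 1) * |t| := by
    rw [← Complex.ofReal_one, ← Complex.ofReal_add, Complex.norm_of_nonneg (by positivity)]
  have hc := continuous_defect ω zs (by
    intro z hz
    obtain ⟨j, -, rfl⟩ := List.mem_map.1 hz
    fun_prop) (by
    intro z hz t h
    obtain ⟨j, -, rfl⟩ := List.mem_map.1 hz
    have := hnorm j t
    rw [show (1 + ((j + 1) * |t| : ℝ) : ℂ) = 0 from h, norm_zero] at this
    have h' : 0 ≤ (j + 1) * |t| := by positivity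
    linarith)
  have h := hc.ext_on (dense_compl_singleton (0 : ℝ)) continuous_const (fun t ht => by
    have ht' : 0 < |t| := abs_pos.2 ht
    refine defect_eq_zero hω n (by simp [zs]) ⟨?_, ?_⟩ one_ne_zero
    · simp only [zs, List.map_map, Function.comp_def, hnorm]
      refine List.Nodup.map (fun a b hab => ?_) List.nodup_range
      have := add_right_cancel (mul_right_cancel₀ ht'.ne' (add_left_cancel hab))
      exact_mod_cast this
    · intro x hx
      simp only [zs, List.map_map, List.mem_map, Function.comp_def] at hx
      obtain ⟨j, -, rfl⟩ := hx
      rw [hnorm]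
      have : 0 < (j + 1) * |t| := by positivity
      linarith)
  simpa [zs, Function.comp_def] using congrFun h 0

theorem oddPart_evenPart_at_ones (hω : ω ^ 2 + ω + 1 = 0) (n : ℕ) :
    (1 - ω) * (-ω) ^ (2 * n) * oddPart ω (List.replicate (2 * n + 1) 1) +
      2 ^ (2 * n) * evenPart ω (-1 :: List.replicate (2 * n + 1) 1) = 0 := by
  have hω0 : ω ≠ 0 := by rintro rfl; norm_num at hω
  have h := defect_replicate_one hω n
  have hs : evenPart ω (1 :: -1 :: List.replicate (2 * n) 1) =
      evenPart ω (-1 :: 1 :: List.replicate (2 * n) 1) := by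
    refine part0_swap hω (by simp) (IsUnit.mk0 _ fun h0 => ?_) [] _
    have : ω = -1 := by linear_combination -h0
    rw [this] at hω
    norm_num at hω
  have e1 : 1 + ω ^ 2 = -ω := by linear_combination hω
  rw [defect, hs] at h
  simp only [List.map_replicate, List.prod_replicate, inv_one, mul_one, one_pow, e1,
    List.length_replicate] at h
  refine mul_left_cancel₀ (mul_ne_zero two_ne_zero hω0) ?_
  rw [List.replicate_succ]
  linear_combination h

end Evaluations

section Matrices

variable {ω : ℂ}

/-- The vertical edge states can change from `v` above a row to `w` below it, when the horizontal
edge at the left end of the row has state `h` and the one at the right end has state `false`. -/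
def RowTransition {N : ℕ} (h : Bool) (v w : Fin N → Bool) : Prop :=
  ∑ k, ((w k).toNat - (v k).toNat : ℤ) = h.toNat ∧
    ∀ j, ∃ g : Bool, ∑ k, (if j < k then ((w k).toNat - (v k).toNat : ℤ) else 0) = g.toNat

theorem rowTransition_zero (h : Bool) (v w : Fin 0 → Bool) :
    RowTransition h v w ↔ h = false := by
  cases h <;> simp [RowTransition]

theorem rowTransition_succ {N : ℕ} (h : Bool) (v w : Fin (N + 1) → Bool) :
    RowTransition h v w ↔ ∃ g : Bool, ((w 0).toNat - (v 0).toNat : ℤ) + g.toNat = h.toNat ∧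
      RowTransition g (Fin.tail v) (Fin.tail w) := by
  simp only [RowTransition, Fin.forall_fin_succ, Fin.sum_univ_succ, Fin.tail, Fin.succ_pos,
    Fin.succ_lt_succ_iff, Fin.not_lt_zero, if_true, if_false, zero_add]
  constructor
  · rintro ⟨h1, ⟨g, hg⟩, h2⟩
    exact ⟨g, by rw [← hg, h1], hg, h2⟩
  · rintro ⟨g, h1, hg, h2⟩
    exact ⟨by rw [hg, h1], ⟨g, hg⟩, h2⟩

open Classical in
theorem rowOp_ones {R : Type*} [CommRing R] (ω : R) (N : ℕ) (h : Bool) (f : List Bool → R)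
    (v : Fin N → Bool) :
    rowOp ω 1 (List.replicate N 1) h f (List.ofFn v) =
      (ω - 1) ^ N * ∑ w : Fin N → Bool,
        if RowTransition h v w then f (List.ofFn w) else 0 := by
  induction N generalizing h f with
  | zero => cases h <;> simp [rowOp, rowTransition_zero]
  | succ N ih =>
    rw [← (Fin.consEquiv fun _ => Bool).sum_comp, Fintype.sum_prod_type, Fintype.sum_bool]
    simp only [Fin.consEquiv_apply, rowTransition_succ, Fin.cons_zero]
    rw [List.replicate_succ, List.ofFn_succ]
    generalize hv : v 0 = a
    cases a <;> cases h <;> simp [rowOp, ih, Fin.tail_def] <;> ring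

/-- A symmetric matrix whose part on and above the diagonal is a configuration of the six-vertex
model with boundary states `v` at the top; for `v = 0` this is a DSASM. -/
def IsBoundaryDSASM {N : ℕ} (v : Fin N → Bool) (A : Matrix (Fin N) (Fin N) ℤ) : Prop :=
  (∀ i j, A i j = A j i) ∧
  (∀ i j, i < j → ∃ b : Bool, (v j).toNat + ∑ k, (if k ≤ i then A k j else 0) = b.toNat) ∧
  (∀ i j, i ≤ j → ∃ b : Bool, ∑ k, (if j < k then A i k else 0) = b.toNat) ∧
  ∀ i, (v i).toNat + ∑ k, A i k = 1

/-- The matrix obtained from `A` by adding a first row and column, which change the vertical edge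
states from `v` to `w` and whose first horizontal edge has state `h`. -/
def addRow {N : ℕ} (v : Fin (N + 1) → Bool) (h : Bool) (w : Fin N → Bool)
    (A : Matrix (Fin N) (Fin N) ℤ) : Matrix (Fin (N + 1)) (Fin (N + 1)) ℤ :=
  Matrix.of (Fin.cons
    (Fin.cons (1 - (v 0).toNat - h.toNat) fun j => (w j).toNat - (v j.succ).toNat)
    fun i => Fin.cons ((w i).toNat - (v i.succ).toNat) (A i))

theorem toNat_injective : Function.Injective fun b : Bool => (b.toNat : ℤ) := by
  decide

theorem addRow_injective {N : ℕ} (v : Fin (N + 1) → Bool) {h h' : Bool} {w w' : Fin N → Bool}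
    {A A' : Matrix (Fin N) (Fin N) ℤ} (e : addRow v h w A = addRow v h' w' A') :
    h = h' ∧ w = w' ∧ A = A' := by
  refine ⟨?_, ?_, ?_⟩
  · have := congrFun (congrFun e 0) 0
    simp only [addRow, Matrix.of_apply, Fin.cons_zero] at this
    exact toNat_injective (by simpa using this)
  · funext j
    have := congrFun (congrFun e 0) j.succ
    simp only [addRow, Matrix.of_apply, Fin.cons_zero, Fin.cons_succ] at this
    exact toNat_injective (by simpa using this)
  · funext i j
    simpa [addRow] using congrFun (congrFun e i.succ) j.succ

theorem isBoundaryDSASM_succ {N : ℕ} (v : Fin (N + 1) → Bool)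
    (A : Matrix (Fin (N + 1)) (Fin (N + 1)) ℤ) :
    IsBoundaryDSASM v A ↔ ∃ h w B, RowTransition h (Fin.tail v) w ∧ IsBoundaryDSASM w B ∧
      addRow v h w B = A := by
  constructor
  · rintro ⟨hs, hc, hr, ht⟩
    choose w hw using fun j : Fin N => hc 0 j.succ (Fin.succ_pos j)
    choose g hg using fun j : Fin N => hr 0 j.succ (Fin.zero_le _)
    obtain ⟨h, hh⟩ := hr 0 0 le_rfl
    have hw' (j : Fin N) : A 0 j.succ = (w j).toNat - (v j.succ).toNat := by
      have := hw j
      simp at this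
      linarith
    have hs0 (j : Fin N) : A j.succ 0 = A 0 j.succ := hs _ _
    refine ⟨h, w, A.submatrix Fin.succ Fin.succ, ⟨?_, fun j => ⟨g j, ?_⟩⟩, ⟨fun i j => hs _ _,
      fun i j hij => ?_, fun i j hij => ?_, fun i => ?_⟩, ?_⟩
    · simpa [Fin.sum_univ_succ, hw', Fin.tail] using hh
    · simpa [Fin.sum_univ_succ, hw', Fin.tail] using hg j
    · obtain ⟨b, hb⟩ := hc i.succ j.succ (Fin.succ_lt_succ_iff.2 hij)
      refine ⟨b, ?_⟩
      rw [← hb]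
      simp [Fin.sum_univ_succ, hw', ← add_assoc]
    · obtain ⟨b, hb⟩ := hr i.succ j.succ (Fin.succ_le_succ_iff.2 hij)
      refine ⟨b, ?_⟩
      rw [← hb]
      simp [Fin.sum_univ_succ]
    · rw [← ht i.succ]
      simp [Fin.sum_univ_succ, hs0, hw', ← add_assoc]
    · have h0 := ht 0
      simp only [Fin.sum_univ_succ, lt_irrefl, if_false, Fin.succ_pos, if_true, zero_add] at h0 hh
      ext i j
      cases i using Fin.cases <;> cases j using Fin.cases <;> simp [addRow, hs0, hw']
      linarith
  · rintro ⟨h, w, B, ⟨h1, h2⟩, ⟨hs, hc, hr, ht⟩, rfl⟩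
    refine ⟨fun i j => ?_, fun i j hij => ?_, fun i j hij => ?_, fun i => ?_⟩
    · cases i using Fin.cases <;> cases j using Fin.cases <;> simp [addRow, hs]
    · obtain ⟨j, rfl⟩ := Fin.exists_succ_eq.2 (Fin.ne_zero_of_lt hij)
      cases i using Fin.cases with
      | zero => exact ⟨w j, by simp [addRow]⟩
      | succ i =>
        obtain ⟨b, hb⟩ := hc i j (Fin.succ_lt_succ_iff.1 hij)
        exact ⟨b, by rw [← hb]; simp [addRow, Fin.sum_univ_succ, ← add_assoc]⟩
    · cases i using Fin.cases with
      | zero =>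
        cases j using Fin.cases with
        | zero => exact ⟨h, by simpa [addRow, Fin.sum_univ_succ, Fin.tail] using h1⟩
        | succ j =>
          obtain ⟨g, hg⟩ := h2 j
          exact ⟨g, by simpa [addRow, Fin.sum_univ_succ, Fin.tail] using hg⟩
      | succ i =>
        obtain ⟨j, rfl⟩ := Fin.exists_succ_eq.2 (Fin.ne_zero_of_lt (i.succ_pos.trans_le hij))
        obtain ⟨b, hb⟩ := hr i j (Fin.succ_le_succ_iff.1 hij)
        exact ⟨b, by rw [← hb]; simp [addRow, Fin.sum_univ_succ]⟩
    · cases i using Fin.cases with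
      | zero =>
        have : ∑ k, ((w k).toNat - (v k.succ).toNat : ℤ) = h.toNat := h1
        simp only [addRow, Fin.sum_univ_succ, Matrix.of_apply, Fin.cons_zero, Fin.cons_succ, this]
        ring
      | succ i =>
        rw [← ht i]
        simp [addRow, Fin.sum_univ_succ, ← add_assoc]

open Classical in
/-- The finite set of matrices satisfying `IsBoundaryDSASM v`. -/
noncomputable def boundaryDSASMs : (N : ℕ) → (Fin N → Bool) → Finset (Matrix (Fin N) (Fin N) ℤ)
  | 0, _ => {0}
  | N + 1, v =>
    ((univ.filter fun p : Bool × (Fin N → Bool) => RowTransition p.1 (Fin.tail v) p.2).sigma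
      fun p => boundaryDSASMs N p.2).image fun s => addRow v s.1.1 s.1.2 s.2

theorem mem_boundaryDSASMs {N : ℕ} (v : Fin N → Bool) (A : Matrix (Fin N) (Fin N) ℤ) :
    A ∈ boundaryDSASMs N v ↔ IsBoundaryDSASM v A := by
  induction N with
  | zero => simp [boundaryDSASMs, IsBoundaryDSASM, Subsingleton.elim A 0]
  | succ N ih =>
    rw [isBoundaryDSASM_succ]
    simp [boundaryDSASMs, ih, and_assoc]

open Classical in
theorem sum_boundaryDSASMs_succ {M : Type*} [AddCommMonoid M] {N : ℕ} (v : Fin (N + 1) → Bool)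
    (f : Matrix (Fin (N + 1)) (Fin (N + 1)) ℤ → M) :
    ∑ A ∈ boundaryDSASMs (N + 1) v, f A = ∑ h : Bool, ∑ w : Fin N → Bool,
      if RowTransition h (Fin.tail v) w then
        ∑ A ∈ boundaryDSASMs N w, f (addRow v h w A) else 0 := by
  rw [boundaryDSASMs, sum_image, sum_sigma, sum_filter, Fintype.sum_prod_type]
  rintro ⟨⟨h, w⟩, A⟩ - ⟨⟨h', w'⟩, A'⟩ - e
  obtain ⟨rfl, rfl, rfl⟩ := addRow_injective v e
  rfl

theorem sum_ite_mul {R ι : Type*} [Semiring R] (s : Finset ι) (P : ι → Prop) [DecidablePred P]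
    (c : R) (f : ι → R) :
    ∑ x ∈ s, (if P x then c * f x else 0) = c * ∑ x ∈ s, if P x then f x else 0 := by
  simp [mul_sum]

theorem part_ones {R : Type*} [CommRing R] (ω β : R) (γ : R → R) (N : ℕ) (v : Fin N → Bool) :
    part ω β γ (List.replicate N 1) (List.ofFn v) = (ω - 1) ^ (∑ i ∈ range N, i) *
      ∑ A ∈ boundaryDSASMs N v, ∏ i, if A i i = 0 then γ 1 else β := by
  induction N with
  | zero => simp [part, boundaryDSASMs]
  | succ N ih =>
    have hk (h : Bool) : kmat β γ 1 (v 0) h =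
        if (1 - (v 0).toNat - h.toNat : ℤ) = 0 then γ 1 else β := by
      cases h <;> cases v 0 <;> simp [kmat]
    rw [List.replicate_succ, List.ofFn_succ,
      show (fun i : Fin N => v i.succ) = Fin.tail v from rfl, part, rowOp_ones, rowOp_ones,
      sum_boundaryDSASMs_succ, Fintype.sum_bool, sum_range_succ, pow_add]
    simp only [ih, Fin.prod_univ_succ, addRow, Matrix.of_apply, Fin.cons_zero, Fin.cons_succ,
      ← hk, ← mul_sum, sum_ite_mul]
    ring

theorem IsBoundaryDSASM.col_prefix {N : ℕ} {A : Matrix (Fin N) (Fin N) ℤ}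
    (h : IsBoundaryDSASM (fun _ => false) A) (i j : Fin N) :
    ∃ b : Bool, ∑ k, (if k ≤ i then A k j else 0) = b.toNat := by
  obtain ⟨hs, hc, hr, ht⟩ := h
  rcases lt_or_ge i j with hij | hij
  · simpa using hc i j hij
  · obtain ⟨b, hb⟩ := hr j i hij
    have h1 : ∑ k, (if k ≤ i then A k j else 0) + ∑ k, (if i < k then A j k else 0) = 1 := by
      rw [← ht j, ← sum_add_distrib]
      simp only [Bool.toNat_false, Nat.cast_zero, zero_add]
      refine sum_congr rfl fun k _ => ?_
      rcases le_or_gt k i with hk | hk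
      · simp [hk, hk.not_gt, hs k j]
      · simp [hk, hk.not_ge]
    refine ⟨!b, ?_⟩
    rw [eq_sub_of_add_eq h1, hb]
    cases b <;> rfl

theorem isDSASM_iff {N : ℕ} (A : Matrix (Fin N) (Fin N) ℤ) :
    IsDSASM A ↔ IsBoundaryDSASM (fun _ => false) A := by
  have hb (x : ℤ) : (∃ b : Bool, x = b.toNat) ↔ x = 0 ∨ x = 1 := by simp
  constructor
  · rintro ⟨⟨-, hr, hc, ht, -⟩, hs⟩
    simp only [sum_filter] at hr hc
    refine ⟨fun i j => hs.apply j i, fun i j _ => ?_, fun i j _ => ?_, fun i => by simpa using ht i⟩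
    · simpa [hb] using hc j i
    · obtain ⟨b, hb'⟩ := (hb _).2 (hr i j)
      have h1 : ∑ k, (if k ≤ j then A i k else 0) + ∑ k, (if j < k then A i k else 0) = 1 := by
        rw [← ht i, ← sum_add_distrib]
        refine sum_congr rfl fun k _ => ?_
        rcases le_or_gt k j with hk | hk
        · simp [hk, hk.not_gt]
        · simp [hk, hk.not_ge]
      refine ⟨!b, ?_⟩
      rw [eq_sub_of_add_eq' h1, hb']
      cases b <;> rfl
  · intro h
    have hp (i j) := (hb _).1 (h.col_prefix i j)
    have hs := h.1
    have ht (i) : ∑ j, A i j = 1 := by simpa using h.2.2.2 i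
    refine ⟨⟨fun i j => ?_, fun i k => ?_, fun j k => ?_, ht, fun j => ?_⟩,
      Matrix.IsSymm.ext fun i j => hs j i⟩
    · have h1 := hp i j
      rw [← sum_filter] at h1
      rcases Nat.eq_zero_or_pos i.1 with hi | hi
      · have : univ.filter (fun k => k ≤ i) = {i} := by
          ext k
          simp only [mem_filter, mem_univ, true_and, mem_singleton, Fin.ext_iff,
            Fin.le_iff_val_le_val]
          omega
        rw [this, sum_singleton] at h1
        omega
      · have h2 := hp ⟨i.1 - 1, by omega⟩ j
        rw [← sum_filter] at h2
        have : univ.filter (fun k => k ≤ i) =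
            insert i (univ.filter (fun k => k ≤ (⟨i.1 - 1, by omega⟩ : Fin N))) := by
          ext k
          simp only [mem_filter, mem_univ, true_and, mem_insert, Fin.ext_iff,
            Fin.le_iff_val_le_val]
          omega
        rw [this, sum_insert (by simp [Fin.le_iff_val_le_val]; omega)] at h1
        omega
    · simpa only [sum_filter, hs i] using hp k i
    · simpa only [sum_filter] using hp k j
    · simpa only [hs j] using ht j

theorem snd_prod_ite_eps {ι : Type*} [Fintype ι] (p : ι → Prop) [DecidablePred p] (c : ℂ) :
    (∏ i, if p i then (TrivSqZeroExt.inlHom ℂ ℂ c) else (DualNumber.eps : DualNumber ℂ)).snd =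
      if (univ.filter fun i => ¬ p i).card = 1 then c ^ (Fintype.card ι - 1) else 0 := by
  have hcard : (univ.filter p).card + (univ.filter fun i => ¬ p i).card = Fintype.card ι := by
    simpa using card_filter_add_card_filter_not (s := univ) p
  rw [prod_ite, prod_const, prod_const, ← map_pow, snd_inlHom_mul, ← hcard]
  rcases (univ.filter fun i => ¬ p i).card with _ | _ | k
  · simp
  · simp
  · simp [pow_succ, mul_assoc]

theorem oddPart_ones (hω : ω ^ 2 + ω + 1 = 0) (N : ℕ) :
    oddPart ω (List.replicate N 1) = (ω - 1) ^ (∑ i ∈ range N, i) * ((-ω) ^ (N - 1) *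
      ((boundaryDSASMs N fun _ => false).filter fun A =>
        (univ.filter fun i => A i i ≠ 0).card = 1).card) := by
  have h1 : (1 : DualNumber ℂ) + TrivSqZeroExt.inlHom ℂ ℂ ω ^ 2 =
      TrivSqZeroExt.inlHom ℂ ℂ (-ω) := by
    rw [← map_one (TrivSqZeroExt.inlHom ℂ ℂ), ← map_pow, ← map_add]
    congr 1
    linear_combination hω
  have h2 : (TrivSqZeroExt.inlHom ℂ ℂ ω - 1) = TrivSqZeroExt.inlHom ℂ ℂ (ω - 1) := by
    rw [map_sub, map_one]
  rw [oddPart, part0, List.map_replicate, List.map_replicate, map_one, ← List.ofFn_const N false,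
    part_ones, h1, h2, ← map_pow, snd_inlHom_mul, TrivSqZeroExt.snd_sum]
  simp only [snd_prod_ite_eps, ← sum_filter, sum_const, nsmul_eq_mul, Fintype.card_fin]
  rw [mul_comm (Finset.card _ : ℂ)]

theorem rowTransition_false_iff {N : ℕ} (w : Fin N → Bool) :
    RowTransition false (fun _ => false) w ↔ w = fun _ => false := by
  refine ⟨fun h => ?_, fun h => by simp [h, RowTransition]⟩
  have h0 : ∑ k, (w k).toNat = 0 := by
    have := h.1
    push_cast [← @Nat.cast_inj ℤ]
    simpa using this
  funext k
  simpa using (sum_eq_zero_iff.1 h0) k (mem_univ k)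

theorem RowTransition.sum_toNat {N : ℕ} {w : Fin N → Bool}
    (h : RowTransition true (fun _ => false) w) : ∑ k, (w k).toNat = 1 := by
  have := h.1
  push_cast [← @Nat.cast_inj ℤ]
  simpa using this

open Classical in
theorem rowOp_neg_one_ones (hω : ω ^ 2 + ω + 1 = 0) (N : ℕ) (f : List Bool → ℂ) :
    ω ^ 2 * rowOp ω (-1) (List.replicate N 1) true f (List.replicate N false) =
      (ω ^ 2) ^ N * (ω - 1) * ∑ w : Fin N → Bool, if RowTransition true (fun _ => false) w then
        (-1) ^ (∑ j : Fin N, j * (w j).toNat) * f (List.ofFn w) else 0 := by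
  induction N generalizing f with
  | zero => simp [rowOp, rowTransition_zero]
  | succ N ih =>
    have hf : rowOp ω (-1) (List.replicate N 1) false (fun l => f (true :: l))
        (List.replicate N false) = (ω ^ 2) ^ N * f (true :: List.replicate N false) := by
      have := rowOp_false_map_false ω (-1) (List.replicate N 1) fun l => f (true :: l)
      rw [List.map_replicate, List.map_replicate, List.prod_replicate] at this
      rw [this]
      congr 2
      linear_combination -hω
    have hs (w : Fin N → Bool) (hw : RowTransition true (fun _ => false) w) :
        ((-1 : ℂ)) ^ (∑ j : Fin N, (j + 1 : ℕ) * (w j).toNat) =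
          -(-1) ^ (∑ j : Fin N, j * (w j).toNat) := by
      simp only [add_mul, sum_add_distrib, one_mul, hw.sum_toNat, pow_succ, mul_neg, mul_one]
    have ht (w : Fin N → Bool) (x : ℂ) : (if RowTransition true (fun _ => false) w then
        (-1) ^ (∑ j : Fin N, (j + 1 : ℕ) * (w j).toNat) * x else 0) =
        -(if RowTransition true (fun _ => false) w then
        (-1) ^ (∑ j : Fin N, j * (w j).toNat) * x else 0) := by
      split_ifs with hw
      · rw [hs w hw, neg_mul]
      · simp
    have hi := ih fun l => f (false :: l)
    rw [← (Fin.consEquiv fun _ => Bool).sum_comp, Fintype.sum_prod_type, Fintype.sum_bool]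
    simp only [Fin.consEquiv_apply, rowTransition_succ, Fin.cons_zero, Fin.sum_univ_succ,
      Fin.cons_succ, Fin.val_succ, Fin.val_zero, zero_mul, zero_add]
    simp [Fin.tail_def, rowTransition_false_iff, rowOp, List.replicate_succ, hf, ht, mul_add]
    linear_combination (-ω ^ 2) * hi + ω ^ 2 * rowOp ω (-1) (List.replicate N 1) true
      (fun l => f (false :: l)) (List.replicate N false) * hω

theorem neg_one_pow_Tstat_addRow {N : ℕ} (w : Fin N → Bool) (A : Matrix (Fin N) (Fin N) ℤ) :
    (-1 : ℂ) ^ Tstat (addRow (fun _ => false) true w A) = (-1) ^ (∑ j : Fin N, j * (w j).toNat) := by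
  have h : Tstat (addRow (fun _ => false) true w A) =
      ∑ j : Fin N, j * (w j).toNat + 2 * ∑ j, (w j).toNat := by
    simp [Tstat, sum_filter, Fintype.sum_prod_type, Fin.sum_univ_succ, addRow, mul_sum,
      ← sum_add_distrib, add_assoc, add_mul, two_mul]
  rw [h, pow_add, pow_mul, neg_one_sq, one_pow, mul_one]

theorem evenPart_neg_one_ones (hω : ω ^ 2 + ω + 1 = 0) (N : ℕ) :
    ω ^ 2 * evenPart ω (-1 :: List.replicate N 1) =
      (ω ^ 2) ^ N * (ω - 1) ^ (∑ i ∈ range N, i + 1) *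
        ∑ A ∈ (boundaryDSASMs (N + 1) fun _ => false).filter fun A => ∀ i, A i i = 0,
          (-1) ^ Tstat A := by
  have h1 : evenPart ω (-1 :: List.replicate N 1) = rowOp ω (-1) (List.replicate N 1) true
      (part ω 0 (fun _ => 1) (List.replicate N 1)) (List.replicate N false) := by
    simp [evenPart, part0, part, kmat]
  rw [h1, rowOp_neg_one_ones hω, pow_succ (ω - 1), sum_filter, sum_boundaryDSASMs_succ,
    Fintype.sum_bool]
  simp only [part_ones, prod_ite_zero, neg_one_pow_Tstat_addRow, Fin.forall_fin_succ]
  simp [addRow]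
  rw [mul_sum, mul_sum]
  refine sum_congr rfl fun w _ => ?_
  rw [show Fin.tail (fun _ : Fin (N + 1) => false) = fun _ => false from rfl]
  split_ifs with hw
  · rw [← sum_filter, sum_const, nsmul_eq_mul]
    ring
  · simp

end Matrices

/-- |OSASM(2n+1)| = 2^{2n} · X^O_{2n+2}(1,-1) = 2^{2n} ∑_{A ∈ OSASM(2n+2)} (-1)^{T(A)}. -/
theorem osasm_odd_count_eq (n : ℕ) :
    (Nat.card {A : Matrix (Fin (2*n+1)) (Fin (2*n+1)) ℤ // IsOSASModd A} : ℚ) =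
      2 ^ (2*n) *
        ∑ᶠ A ∈ {A : Matrix (Fin (2*n+2)) (Fin (2*n+2)) ℤ | IsOSASMeven A},
          ((-1 : ℚ)) ^ Tstat A := by
  classical
  obtain ⟨ω, hω⟩ : ∃ ω : ℂ, ω ^ 2 + ω + 1 = 0 := by
    obtain ⟨ω, h⟩ := IsAlgClosed.exists_pow_nat_eq (-3 : ℂ) two_pos
    exact ⟨(ω - 1) / 2, by linear_combination h / 4⟩
  have hω0 : ω ≠ 0 := by
    rintro rfl
    norm_num at hω
  have hω1 : ω - 1 ≠ 0 := fun h => by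
    rw [sub_eq_zero.1 h] at hω
    norm_num at hω
  have hodd : {A : Matrix (Fin (2*n+1)) (Fin (2*n+1)) ℤ | IsOSASModd A} =
      ((boundaryDSASMs (2*n+1) fun _ => false).filter fun A =>
        (univ.filter fun i => A i i ≠ 0).card = 1 : Finset _) := by
    ext A
    simp only [Set.mem_ofPred_eq, coe_filter, mem_boundaryDSASMs, IsOSASModd, isDSASM_iff]
  have heven : {A : Matrix (Fin (2*n+2)) (Fin (2*n+2)) ℤ | IsOSASMeven A} =
      ((boundaryDSASMs (2*n+2) fun _ => false).filter fun A => ∀ i, A i i = 0 : Finset _) := by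
    ext A
    simp only [Set.mem_ofPred_eq, coe_filter, mem_boundaryDSASMs, IsOSASMeven, isDSASM_iff]
  rw [heven, finsum_mem_coe_finset, ← Set.coe_ofPred, Nat.card_coe_set_eq, hodd,
    Set.ncard_coe_finset]
  have h := oddPart_evenPart_at_ones hω n
  have he := evenPart_neg_one_ones hω (2 * n + 1)
  rw [oddPart_ones hω, Nat.add_sub_cancel] at h
  have h2 : (-ω) ^ (2 * n) = ω ^ (2 * n) := (even_two_mul n).neg_pow ω
  rw [h2] at h
  rw [pow_succ (ω - 1)] at he
  rw [← Rat.cast_inj (α := ℂ)]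
  push_cast
  have hc : ω ^ 2 * ω ^ (4 * n) * (ω - 1) ^ (∑ i ∈ range (2 * n + 1), i) * (ω - 1) ≠ 0 := by
    positivity
  refine mul_left_cancel₀ hc ?_
  linear_combination (-ω ^ 2) * h + 2 ^ (2 * n) * he
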